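/- arXiv:1402.4911 — 7 statements merged into one kernel-verified Lean document; each statement's English description precedes it below -/
import Mathlib

section
/- Let H be a complex Hilbert space, A a bounded self-adjoint operator on H, t ∈ ℝ, and L a linear subspace of H. Suppose u ∈ L and τ ∈ ℝ satisfy: τ < 0, (A − t)u ≠ 0, and ⟪(A − t)u, v⟫ = τ · ⟪(A − t)u, (A − t)v⟫ for all v ∈ L (that is, (τ, u) solves the weak eigenvalue problem m¹_t(u,v) = τ m²_t(u,v) on the trial subspace L, in the coefficient-free case P = I). Then there exists λ ∈ ℝ with t + 1/τ ≤ λ ≤ t and (λ : ℂ) ∈ spectrum ℂ A. (This is the abstract lower-bound half of the paper's Theorem 3.1: a negative eigenvalue τ of the weak problem certifies spectrum of A in the interval [t + 1/τ, t].) -/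
open scoped InnerProductSpace

/-- If the spectrum of a self-adjoint operator `A` avoids `[a, b]`, then the quadratic form of
`(A - b) (A - a)` vanishes only at `0`. -/
theorem IsSelfAdjoint.eq_zero_of_inner_eq_zero_of_forall_notMem_spectrum
    {H : Type*} [NormedAddCommGroup H] [InnerProductSpace ℂ H] [CompleteSpace H]
    {A : H →L[ℂ] H} (hA : IsSelfAdjoint A) {a b : ℝ} (hab : a ≤ b)
    (hspec : ∀ x : ℝ, a ≤ x → x ≤ b → (x : ℂ) ∉ spectrum ℂ A) {u : H}
    (hu : ⟪(A - (b : ℂ) • 1) u, (A - (a : ℂ) • 1) u⟫_ℂ = 0) : u = 0 := by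
  have hpos : ∀ x ∈ spectrum ℝ A, 0 < (x - b) * (x - a) := by
    intro x hx
    have hx' : (x : ℂ) ∈ spectrum ℂ A := (spectrum.algebraMap_mem_iff ℂ).mpr hx
    rcases lt_or_ge x a with h | h
    · exact mul_pos_of_neg_of_neg (by linarith) (by linarith)
    · have h' : b < x := lt_of_not_ge fun h' => hspec x h h' hx'
      exact mul_pos (by linarith) (by linarith)
  have hsub (c : ℝ) : cfc (fun x : ℝ => x - c) A = A - (c : ℂ) • 1 := by
    rw [cfc_sub (fun x : ℝ => x) (fun _ => c) A, cfc_id' ℝ A, cfc_const c A,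
      Algebra.algebraMap_eq_smul_one]
    simp
  have hadj : IsSelfAdjoint (A - (b : ℂ) • 1) := hsub b ▸ cfc_predicate _ A
  let g : ℝ → ℝ := fun x => √((x - b) * (x - a))
  have hg : ContinuousOn g (spectrum ℝ A) := by fun_prop
  have hg0 : ∀ x ∈ spectrum ℝ A, g x ≠ 0 := fun x hx => (Real.sqrt_pos.mpr (hpos x hx)).ne'
  have hS : IsSelfAdjoint (cfc g A) := cfc_predicate _ A
  have hSS : cfc g A * cfc g A = (A - (b : ℂ) • 1) * (A - (a : ℂ) • 1) := by
    rw [← cfc_mul g g A, ← hsub b, ← hsub a, ← cfc_mul (fun x : ℝ => x - b) (fun x => x - a) A]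
    exact cfc_congr fun x hx => Real.mul_self_sqrt (hpos x hx).le
  have hSu : cfc g A u = 0 := by
    rw [← inner_self_eq_zero (𝕜 := ℂ), hS.isSymmetric.apply_clm, ← mul_apply_eq_comp,
      hSS, mul_apply_eq_comp, ← hadj.isSymmetric.apply_clm]
    exact hu
  have hinv : cfc (fun x => (g x)⁻¹) A * cfc g A = 1 := by
    rw [← cfc_mul (fun x => (g x)⁻¹) g A (hg.inv₀ hg0) hg, ← cfc_one ℝ A]
    exact cfc_congr fun x hx => inv_mul_cancel₀ (hg0 x hx)
  simpa [hSu] using (DFunLike.congr_fun hinv u).symm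

theorem zimmermann_mertins_lower_bound
    {H : Type*} [NormedAddCommGroup H] [InnerProductSpace ℂ H] [CompleteSpace H]
    (A : H →L[ℂ] H) (hA : IsSelfAdjoint A) (t : ℝ) (L : Submodule ℂ H)
    (u : H) (hu : u ∈ L) (τ : ℝ) (hτ : τ < 0)
    (hne : (A - (t : ℂ) • 1) u ≠ 0)
    (hweak : ∀ v ∈ L,
      ⟪(A - (t : ℂ) • 1) u, v⟫_ℂ
        = (τ : ℂ) * ⟪(A - (t : ℂ) • 1) u, (A - (t : ℂ) • 1) v⟫_ℂ) :
    ∃ lam : ℝ, t + 1 / τ ≤ lam ∧ lam ≤ t ∧ (lam : ℂ) ∈ spectrum ℂ A := by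
  by_contra! hspec
  have hle : t + 1 / τ ≤ t := by linarith [one_div_neg.mpr hτ]
  have hτ0 : (τ : ℂ) ≠ 0 := by exact_mod_cast hτ.ne
  have hsplit : (A - ((t + 1 / τ : ℝ) : ℂ) • 1) u
      = (A - (t : ℂ) • 1) u - (τ : ℂ)⁻¹ • u := by
    simp [add_smul, sub_sub]
  have hu0 : u = 0 := by
    refine hA.eq_zero_of_inner_eq_zero_of_forall_notMem_spectrum hle hspec ?_
    rw [hsplit, inner_sub_right, inner_smul_right, hweak u hu, inv_mul_cancel_left₀ hτ0, sub_self]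
  exact hne (by rw [hu0, map_zero])
end

section
/- Let H be a complex Hilbert space, A a bounded self-adjoint operator on H, t ∈ ℝ, and L a linear subspace of H. Suppose u ∈ L and τ ∈ ℝ satisfy: τ > 0, (A − t)u ≠ 0, and ⟪(A − t)u, v⟫ = τ · ⟪(A − t)u, (A − t)v⟫ for all v ∈ L (that is, (τ, u) solves the weak eigenvalue problem m¹_t(u,v) = τ m²_t(u,v) on the trial subspace L, in the coefficient-free case P = I). Then there exists λ ∈ ℝ with t ≤ λ ≤ t + 1/τ and (λ : ℂ) ∈ spectrum ℂ A. (This is the abstract upper-bound half of the paper's Theorem 3.1: a positive eigenvalue τ of the weak problem certifies spectrum of A in the interval [t, t + 1/τ].) -/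
open scoped InnerProductSpace

/-- If `τ * x ^ 2 - x` is positive on the spectrum of a self-adjoint `B`, then the quadratic form of
`τ • B ^ 2 - B` is positive definite. -/
lemma IsSelfAdjoint.inner_lt_mul_norm_sq_of_spectrum
    {H : Type*} [NormedAddCommGroup H] [InnerProductSpace ℂ H] [CompleteSpace H]
    {B : H →L[ℂ] H} (hB : IsSelfAdjoint B) {τ : ℝ}
    (hpos : ∀ x ∈ spectrum ℝ B, 0 < τ * x ^ 2 - x) {u : H} (hu : u ≠ 0) :
    (⟪B u, u⟫_ℂ).re < τ * ‖B u‖ ^ 2 := by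
  obtain ⟨ε, hε, hle⟩ := (ContinuousFunctionalCalculus.isCompact_spectrum B).exists_forall_le'
    (f := fun x : ℝ => τ * x ^ 2 - x) (by fun_prop) hpos
  have h1 : algebraMap ℝ (H →L[ℂ] H) ε ≤ cfc (fun x : ℝ => τ * x ^ 2 - x) B :=
    algebraMap_le_cfc _ _ B hle
  have h2 : cfc (fun x : ℝ => τ * x ^ 2 - x) B = τ • B ^ 2 - B := by
    rw [cfc_sub _ _ B, cfc_const_mul _ _ B, cfc_pow_id B 2, cfc_id' ℝ B]
  rw [h2, ContinuousLinearMap.le_def] at h1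
  have h3 := h1.re_inner_nonneg_left u
  have hsym : ⟪B (B u), u⟫_ℂ = ⟪B u, B u⟫_ℂ := hB.isSymmetric (B u) u
  have hu' : 0 < ε * ‖u‖ ^ 2 := by positivity
  have h4 : (⟪(τ • B ^ 2 - B - algebraMap ℝ (H →L[ℂ] H) ε) u, u⟫_ℂ).re
      = τ * ‖B u‖ ^ 2 - (⟪B u, u⟫_ℂ).re - ε * ‖u‖ ^ 2 := by
    simp [Algebra.algebraMap_eq_smul_one, pow_two, inner_smul_left_eq_smul, hsym,
      inner_self_eq_norm_sq_to_K, ← Complex.ofReal_mul]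
  have h5 : 0 ≤ (⟪(τ • B ^ 2 - B - algebraMap ℝ (H →L[ℂ] H) ε) u, u⟫_ℂ).re := h3
  linarith

theorem zimmermann_mertins_upper_bound
    {H : Type*} [NormedAddCommGroup H] [InnerProductSpace ℂ H] [CompleteSpace H]
    (A : H →L[ℂ] H) (hA : IsSelfAdjoint A) (t : ℝ) (L : Submodule ℂ H)
    (u : H) (hu : u ∈ L) (τ : ℝ) (hτ : 0 < τ)
    (hne : (A - (t : ℂ) • 1) u ≠ 0)
    (hweak : ∀ v ∈ L,
      ⟪(A - (t : ℂ) • 1) u, v⟫_ℂ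
        = (τ : ℂ) * ⟪(A - (t : ℂ) • 1) u, (A - (t : ℂ) • 1) v⟫_ℂ) :
    ∃ lam : ℝ, t ≤ lam ∧ lam ≤ t + 1 / τ ∧ (lam : ℂ) ∈ spectrum ℂ A := by
  by_contra! hcon
  have hB : IsSelfAdjoint (A - (t : ℂ) • (1 : H →L[ℂ] H)) :=
    hA.sub (.smul (Complex.conj_ofReal t) (.one _))
  have hu0 : u ≠ 0 := by
    rintro rfl
    simp at hne
  have hpos : ∀ x ∈ spectrum ℝ (A - (t : ℂ) • (1 : H →L[ℂ] H)), 0 < τ * x ^ 2 - x := by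
    intro x hx
    have hxA : ((x + t : ℝ) : ℂ) ∈ spectrum ℂ A := by
      rw [← spectrum.algebraMap_mem_iff ℂ, ← Algebra.algebraMap_eq_smul_one, spectrum.mem_iff] at hx
      rw [spectrum.mem_iff]
      convert hx using 2
      simp
      abel
    by_contra! hneg
    have hx0 : 0 ≤ x := by nlinarith [mul_nonneg hτ.le (sq_nonneg x)]
    have hx1 : x ≤ 1 / τ := by
      rw [le_div_iff₀ hτ]
      by_contra! h
      have : 0 < x := by nlinarith
      nlinarith
    exact hcon (x + t) (by linarith) (by linarith) hxA
  have hlt := hB.inner_lt_mul_norm_sq_of_spectrum hpos hu0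
  rw [hweak u hu, inner_self_eq_norm_sq_to_K] at hlt
  simp [← Complex.ofReal_pow, ← Complex.ofReal_mul] at hlt
end

section
/- Let H be a complex Hilbert space, A a bounded self-adjoint operator on H, and t ∈ ℝ with (t : ℂ) ∉ spectrum ℂ A. Suppose u ∈ H satisfies (A − t)u ≠ 0 and the Rayleigh quotient τ := re⟪(A − t)u, u⟫ / ‖(A − t)u‖² is negative. Then the set S⁻ := {λ : ℝ | λ < t ∧ (λ : ℂ) ∈ spectrum ℂ A} is nonempty and t + 1/τ ≤ sSup S⁻. (Abstract form of the paper's Theorem 3.1 for j = 1: the quantity ρ₁⁻(t) = t + 1/τ is a certified lower bound for ν₁⁻(t), the first spectral point of A strictly to the left of t.) -/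
open scoped InnerProductSpace

/-- If `c * (x - t) ^ 2 ≤ x - t` on the spectrum of a self-adjoint operator `A`, then the
corresponding quadratic form inequality holds. -/
theorem IsSelfAdjoint.mul_norm_sq_le_re_inner_of_spectrum
    {H : Type*} [NormedAddCommGroup H] [InnerProductSpace ℂ H] [CompleteSpace H]
    {A : H →L[ℂ] H} (hA : IsSelfAdjoint A) {t c : ℝ}
    (h : ∀ x : ℝ, (x : ℂ) ∈ spectrum ℂ A → c * (x - t) ^ 2 ≤ x - t) (u : H) :
    c * ‖(A - (t : ℂ) • 1) u‖ ^ 2 ≤ (⟪(A - (t : ℂ) • 1) u, u⟫_ℂ).re := by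
  have hB : cfc (fun x : ℝ ↦ x - t) A = A - (t : ℂ) • 1 := by
    rw [cfc_sub (fun x : ℝ ↦ x) (fun _ ↦ t) A, cfc_id' ℝ A, cfc_const t A,
      Algebra.algebraMap_eq_smul_one, Complex.coe_smul]
  have hle : c • (A - (t : ℂ) • 1) ^ 2 ≤ A - (t : ℂ) • 1 := by
    have := cfc_mono (a := A) (f := fun x : ℝ ↦ c • (x - t) ^ 2) (g := fun x : ℝ ↦ x - t)
      (fun x hx ↦ h x ((spectrum.algebraMap_mem_iff ℂ).mpr hx))
    rwa [cfc_smul c (fun x : ℝ ↦ (x - t) ^ 2) A, cfc_pow (fun x : ℝ ↦ x - t) 2 A, hB] at this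
  have hsa : IsSelfAdjoint (A - (t : ℂ) • 1) := hB ▸ cfc_predicate _ A
  generalize A - (t : ℂ) • (1 : H →L[ℂ] H) = B at hle hsa ⊢
  have hpos := ((ContinuousLinearMap.le_def _ _).mp hle).re_inner_nonneg_left u
  have hsq : ⟪(B ^ 2) u, u⟫_ℂ = (‖B u‖ : ℂ) ^ 2 := by
    rw [pow_two, mul_apply_eq_comp, ← ContinuousLinearMap.adjoint_inner_right,
      hsa.adjoint_eq, inner_self_eq_norm_sq_to_K]
    rfl
  rw [sub_apply, smul_apply, inner_sub_left,
    ← Complex.coe_smul, inner_smul_left, hsq] at hpos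
  simp only [Complex.conj_ofReal, ← Complex.ofReal_pow, ← Complex.ofReal_mul, map_sub,
    RCLike.re_to_complex, Complex.ofReal_re] at hpos
  linarith

theorem rayleigh_lower_bound_for_first_spectral_point_left
    {H : Type*} [NormedAddCommGroup H] [InnerProductSpace ℂ H] [CompleteSpace H]
    (A : H →L[ℂ] H) (hA : IsSelfAdjoint A) (t : ℝ)
    (ht : (t : ℂ) ∉ spectrum ℂ A)
    (u : H) (hne : (A - (t : ℂ) • 1) u ≠ 0)
    (hτ : (⟪(A - (t : ℂ) • 1) u, u⟫_ℂ).re / ‖(A - (t : ℂ) • 1) u‖ ^ 2 < 0) :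
    {lam : ℝ | lam < t ∧ (lam : ℂ) ∈ spectrum ℂ A}.Nonempty ∧
    t + 1 / ((⟪(A - (t : ℂ) • 1) u, u⟫_ℂ).re / ‖(A - (t : ℂ) • 1) u‖ ^ 2)
      ≤ sSup {lam : ℝ | lam < t ∧ (lam : ℂ) ∈ spectrum ℂ A} := by
  have hpos : 0 < ‖(A - (t : ℂ) • 1) u‖ ^ 2 := by positivity
  have key {c : ℝ} (hc : ∀ x : ℝ, (x : ℂ) ∈ spectrum ℂ A → c * (x - t) ^ 2 ≤ x - t) :
      c ≤ (⟪(A - (t : ℂ) • 1) u, u⟫_ℂ).re / ‖(A - (t : ℂ) • 1) u‖ ^ 2 :=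
    (le_div_iff₀ hpos).mpr (hA.mul_norm_sq_le_re_inner_of_spectrum hc u)
  generalize (⟪(A - (t : ℂ) • 1) u, u⟫_ℂ).re / ‖(A - (t : ℂ) • 1) u‖ ^ 2 = τ at hτ key ⊢
  set S := {lam : ℝ | lam < t ∧ (lam : ℂ) ∈ spectrum ℂ A}
  have hSne : S.Nonempty := by
    by_contra hempty
    refine (key (c := 0) fun x hx ↦ ?_).not_gt hτ
    by_contra! hxt
    exact hempty ⟨x, by linarith, hx⟩
  have hbdd : BddAbove S := ⟨t, fun x hx ↦ hx.1.le⟩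
  have hmem : ((sSup S : ℝ) : ℂ) ∈ spectrum ℂ A :=
    closure_minimal (fun x hx ↦ hx.2)
      ((spectrum.isClosed (𝕜 := ℂ) A).preimage Complex.continuous_ofReal)
      (csSup_mem_closure hSne hbdd)
  have hlt : sSup S < t :=
    (csSup_le hSne fun x hx ↦ hx.1.le).lt_of_ne fun h ↦ ht (h ▸ hmem)
  have hd : sSup S - t < 0 := by linarith
  have hτ_ge : 1 / (sSup S - t) ≤ τ := by
    refine key fun x hx ↦ ?_
    rw [one_div_mul_eq_div, div_le_iff_of_neg hd]
    rcases lt_or_ge x t with hxt | hxt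
    · nlinarith [le_csSup hbdd (show x ∈ S from ⟨hxt, hx⟩)]
    · nlinarith [sq_nonneg (x - t)]
  have : 1 / τ ≤ sSup S - t := (one_div_le_of_neg hτ hd).mpr hτ_ge
  exact ⟨hSne, by linarith⟩
end

section
/- Let H be a complex Hilbert space, A a bounded self-adjoint operator on H, and t ∈ ℝ with (t : ℂ) ∉ spectrum ℂ A. Suppose u ∈ H satisfies (A − t)u ≠ 0 and the Rayleigh quotient τ := re⟪(A − t)u, u⟫ / ‖(A − t)u‖² is positive. Then the set S⁺ := {λ : ℝ | t < λ ∧ (λ : ℂ) ∈ spectrum ℂ A} is nonempty and sInf S⁺ ≤ t + 1/τ. (Abstract form of the paper's Theorem 3.1 for j = 1: the quantity ρ₁⁺(t) = t + 1/τ is a certified upper bound for ν₁⁺(t), the first spectral point of A strictly to the right of t.) -/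
open scoped InnerProductSpace

/-- If a real polynomial is positive on the real spectrum of a self-adjoint operator `A`, then the
quadratic form of the polynomial evaluated at `A` is strictly positive away from zero. -/
lemma IsSelfAdjoint.re_inner_aeval_pos
    {H : Type*} [NormedAddCommGroup H] [InnerProductSpace ℂ H] [CompleteSpace H]
    {A : H →L[ℂ] H} (hA : IsSelfAdjoint A) (p : Polynomial ℝ)
    (hp : ∀ x ∈ spectrum ℝ A, 0 < p.eval x) {u : H} (hu : u ≠ 0) :
    0 < (⟪Polynomial.aeval A p u, u⟫_ℂ).re := by
  obtain ⟨c, hc, hcp⟩ : ∃ c : ℝ, 0 < c ∧ ∀ x ∈ spectrum ℝ A, c ≤ p.eval x := by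
    rcases (spectrum ℝ A).eq_empty_or_nonempty with h | h
    · exact ⟨1, one_pos, by simp [h]⟩
    · obtain ⟨x, hx, hmin⟩ :=
        (ContinuousFunctionalCalculus.isCompact_spectrum (R := ℝ) A).exists_isMinOn h
          p.continuous.continuousOn
      exact ⟨p.eval x, hp x hx, fun y hy => hmin hy⟩
  have hnonneg : 0 ≤ Polynomial.aeval A (p - Polynomial.C c) := by
    rw [← cfc_polynomial (p - Polynomial.C c) A hA]
    exact cfc_nonneg fun x hx => by simpa using hcp x hx
  have hpos := ((ContinuousLinearMap.nonneg_iff_isPositive _).1 hnonneg).re_inner_nonneg_left u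
  have hinner : (⟪(algebraMap ℝ (H →L[ℂ] H) c) u, u⟫_ℂ).re = c * ‖u‖ ^ 2 := by
    rw [Algebra.algebraMap_eq_smul_one, smul_apply,
      one_apply_eq_self, ← Complex.coe_smul, inner_smul_left,
      Complex.conj_ofReal, Complex.re_ofReal_mul, ← RCLike.re_to_complex, inner_self_eq_norm_sq]
  simp only [map_sub, Polynomial.aeval_C, sub_apply, inner_sub_left,
    RCLike.re_to_complex, hinner] at hpos
  have : 0 < c * ‖u‖ ^ 2 := by positivity
  linarith

theorem rayleigh_upper_bound_for_first_spectral_point_right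
    {H : Type*} [NormedAddCommGroup H] [InnerProductSpace ℂ H] [CompleteSpace H]
    (A : H →L[ℂ] H) (hA : IsSelfAdjoint A) (t : ℝ)
    (ht : (t : ℂ) ∉ spectrum ℂ A)
    (u : H) (hne : (A - (t : ℂ) • 1) u ≠ 0)
    (hτ : 0 < (⟪(A - (t : ℂ) • 1) u, u⟫_ℂ).re / ‖(A - (t : ℂ) • 1) u‖ ^ 2) :
    {lam : ℝ | t < lam ∧ (lam : ℂ) ∈ spectrum ℂ A}.Nonempty ∧
    sInf {lam : ℝ | t < lam ∧ (lam : ℂ) ∈ spectrum ℂ A}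
      ≤ t + 1 / ((⟪(A - (t : ℂ) • 1) u, u⟫_ℂ).re / ‖(A - (t : ℂ) • 1) u‖ ^ 2) := by
  set B : H →L[ℂ] H := A - (t : ℂ) • 1 with hB
  set τ : ℝ := (⟪B u, u⟫_ℂ).re / ‖B u‖ ^ 2 with hτdef
  suffices h : ∃ x : ℝ, (t < x ∧ (x : ℂ) ∈ spectrum ℂ A) ∧ x ≤ t + 1 / τ by
    obtain ⟨x, hx, hxle⟩ := h
    exact ⟨⟨x, hx⟩, (csInf_le ⟨t, fun y hy => hy.1.le⟩ hx).trans hxle⟩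
  by_contra! hgap
  have hu : u ≠ 0 := by
    rintro rfl
    simp at hne
  have hBsa : IsSelfAdjoint B :=
    hA.sub (IsSelfAdjoint.smul (Complex.conj_ofReal t) (IsSelfAdjoint.one _))
  have hBA : Polynomial.aeval A (Polynomial.X - Polynomial.C t) = B := by
    simp [hB, Algebra.algebraMap_eq_smul_one]
  have hpos := hA.re_inner_aeval_pos
    (Polynomial.C τ * (Polynomial.X - Polynomial.C t) ^ 2 - (Polynomial.X - Polynomial.C t))
    (fun x hx => by
      have hx' : (x : ℂ) ∈ spectrum ℂ A := (spectrum.algebraMap_mem_iff ℂ).2 hx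
      simp only [Polynomial.eval_sub, Polynomial.eval_mul, Polynomial.eval_pow,
        Polynomial.eval_C, Polynomial.eval_X]
      rcases lt_trichotomy x t with h | rfl | h
      · nlinarith [mul_nonneg hτ.le (sq_nonneg (x - t))]
      · exact absurd hx' ht
      · have h1 : 1 / τ < x - t := by linarith [hgap x ⟨h, hx'⟩]
        rw [div_lt_iff₀ hτ] at h1
        nlinarith [mul_pos (sub_pos.2 h) (sub_pos.2 h1)]) hu
  have hsq : ⟪B (B u), u⟫_ℂ = ((‖B u‖ ^ 2 : ℝ) : ℂ) := by
    rw [hBsa.isSymmetric.apply_clm, inner_self_eq_norm_sq_to_K]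
    norm_cast
  have hτmul : τ * ‖B u‖ ^ 2 = (⟪B u, u⟫_ℂ).re :=
    div_mul_cancel₀ _ (by positivity)
  have hinner : (⟪(algebraMap ℝ (H →L[ℂ] H) τ * B ^ 2) u, u⟫_ℂ).re = τ * ‖B u‖ ^ 2 := by
    rw [Algebra.algebraMap_eq_smul_one, smul_mul_assoc, one_mul, smul_apply,
      pow_two, mul_apply_eq_comp, ← Complex.coe_smul, inner_smul_left, hsq,
      Complex.conj_ofReal, ← Complex.ofReal_mul, Complex.ofReal_re]
  rw [map_sub, map_mul, map_pow, hBA, Polynomial.aeval_C, sub_apply,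
    inner_sub_left, Complex.sub_re, hinner, hτmul, sub_self] at hpos
  exact hpos.false
end

section
/- Let H be a complex Hilbert space and A a bounded self-adjoint operator on H. Let t_up < t_low be real numbers, neither of which belongs (as a complex number) to spectrum ℂ A, and assume the real spectrum of A in the open interval (t_up, t_low) consists of exactly one point ω, i.e. {λ : ℝ | t_up < λ ∧ λ < t_low ∧ (λ:ℂ) ∈ spectrum ℂ A} = {ω}. Suppose u⁺ ∈ H satisfies (A − t_up)u⁺ ≠ 0 and τ⁺ := re⟪(A − t_up)u⁺, u⁺⟫ / ‖(A − t_up)u⁺‖² > 0 with t_up + 1/τ⁺ < t_low, and u⁻ ∈ H satisfies (A − t_low)u⁻ ≠ 0 and τ⁻ := re⟪(A − t_low)u⁻, u⁻⟫ / ‖(A − t_low)u⁻‖² < 0 with t_up < t_low + 1/τ⁻. Then t_low + 1/τ⁻ ≤ ω ≤ t_up + 1/τ⁺, i.e. [t_low + 1/τ⁻, t_up + 1/τ⁺] is a certified enclosure for the eigenvalue ω. (Abstract single-eigenvalue version of the certification in the paper's Lemma 4.2, item 3.) -/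
open scoped InnerProductSpace

/-- If the real spectrum of a self-adjoint operator avoids the open interval between `a` and `b`,
then `(A - a) (A - b)` is a positive operator; expressed here as a bound on a quadratic form. -/
lemma sub_mul_re_inner_le_norm_sq_of_spectrum
    {H : Type*} [NormedAddCommGroup H] [InnerProductSpace ℂ H] [CompleteSpace H]
    {A : H →L[ℂ] H} (hA : IsSelfAdjoint A) {a b : ℝ}
    (h : ∀ x : ℝ, (x : ℂ) ∈ spectrum ℂ A → 0 ≤ (x - a) * (x - b)) (u : H) :
    (b - a) * (⟪(A - (a : ℂ) • 1) u, u⟫_ℂ).re ≤ ‖(A - (a : ℂ) • 1) u‖ ^ 2 := by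
  have hsub (c : ℝ) : cfc (fun x : ℝ ↦ x - c) A = A - (c : ℂ) • 1 := by
    rw [cfc_sub (fun x : ℝ ↦ x) (fun _ ↦ c) A, cfc_id' ℝ A, cfc_const c A,
      Algebra.algebraMap_eq_smul_one, Complex.coe_smul]
  have hpos : 0 ≤ (A - (a : ℂ) • 1) * (A - (b : ℂ) • 1) := by
    rw [← hsub a, ← hsub b, ← cfc_mul (fun x : ℝ ↦ x - a) (fun x ↦ x - b) A]
    exact cfc_nonneg fun x hx ↦ h x ((spectrum.algebraMap_mem_iff ℂ).mpr hx)
  have hsa : IsSelfAdjoint (A - (a : ℂ) • 1) := hsub a ▸ cfc_predicate _ A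
  have hinner := ((ContinuousLinearMap.nonneg_iff_isPositive _).mp hpos).re_inner_nonneg_right u
  have hb : (A - (b : ℂ) • 1) u = (A - (a : ℂ) • 1) u - ((b - a : ℝ) : ℂ) • u := by
    simp [sub_smul]
  rw [mul_apply_eq_comp, ← ContinuousLinearMap.adjoint_inner_left,
    hsa.adjoint_eq, hb, inner_sub_right, inner_smul_right, map_sub, inner_self_eq_norm_sq] at hinner
  rw [RCLike.re_to_complex, Complex.re_ofReal_mul] at hinner
  linarith

theorem certified_enclosure_single_eigenvalue
    {H : Type*} [NormedAddCommGroup H] [InnerProductSpace ℂ H] [CompleteSpace H]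
    (A : H →L[ℂ] H) (hA : IsSelfAdjoint A)
    (tup tlow : ℝ) (htt : tup < tlow)
    (hup : (tup : ℂ) ∉ spectrum ℂ A) (hlow : (tlow : ℂ) ∉ spectrum ℂ A)
    (ω : ℝ)
    (hspec : {lam : ℝ | tup < lam ∧ lam < tlow ∧ (lam : ℂ) ∈ spectrum ℂ A} = {ω})
    (uP : H) (hneP : (A - (tup : ℂ) • 1) uP ≠ 0)
    (hτP : 0 < (⟪(A - (tup : ℂ) • 1) uP, uP⟫_ℂ).re / ‖(A - (tup : ℂ) • 1) uP‖ ^ 2)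
    (hPlt : tup + 1 / ((⟪(A - (tup : ℂ) • 1) uP, uP⟫_ℂ).re / ‖(A - (tup : ℂ) • 1) uP‖ ^ 2) < tlow)
    (uM : H) (hneM : (A - (tlow : ℂ) • 1) uM ≠ 0)
    (hτM : (⟪(A - (tlow : ℂ) • 1) uM, uM⟫_ℂ).re / ‖(A - (tlow : ℂ) • 1) uM‖ ^ 2 < 0)
    (hMgt : tup < tlow + 1 / ((⟪(A - (tlow : ℂ) • 1) uM, uM⟫_ℂ).re / ‖(A - (tlow : ℂ) • 1) uM‖ ^ 2)) :
    tlow + 1 / ((⟪(A - (tlow : ℂ) • 1) uM, uM⟫_ℂ).re / ‖(A - (tlow : ℂ) • 1) uM‖ ^ 2) ≤ ω ∧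
    ω ≤ tup + 1 / ((⟪(A - (tup : ℂ) • 1) uP, uP⟫_ℂ).re / ‖(A - (tup : ℂ) • 1) uP‖ ^ 2) := by
  have hω : tup < ω ∧ ω < tlow ∧ (ω : ℂ) ∈ spectrum ℂ A := by
    simpa using hspec.ge (Set.mem_singleton ω)
  have huniq (x : ℝ) (hx : (x : ℂ) ∈ spectrum ℂ A) (h1 : tup < x) (h2 : x < tlow) : x = ω := by
    simpa using hspec.le ⟨h1, h2, hx⟩
  have hNP := pow_pos (norm_pos_iff.mpr hneP) 2
  have hNM := pow_pos (norm_pos_iff.mpr hneM) 2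
  have hpP := (div_pos_iff_of_pos_right hNP).mp hτP
  have hpM := neg_of_div_neg_left hτM hNM.le
  rw [one_div_div, one_div_div]
  constructor
  · have hM := sub_mul_re_inner_le_norm_sq_of_spectrum hA (a := tlow) (b := ω) (fun x hx ↦ by
      rcases le_or_gt x ω with h | h
      · exact mul_nonneg_of_nonpos_of_nonpos (by linarith) (by linarith)
      · rcases lt_or_ge x tlow with h' | h'
        · exact absurd (huniq x hx (hω.1.trans h) h') h.ne'
        · exact mul_nonneg (by linarith) (by linarith)) uM
    linarith [(div_le_iff_of_neg hpM).mpr hM]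
  · have hP := sub_mul_re_inner_le_norm_sq_of_spectrum hA (a := tup) (b := ω) (fun x hx ↦ by
      rcases le_or_gt ω x with h | h
      · exact mul_nonneg (by linarith) (by linarith)
      · rcases lt_or_ge tup x with h' | h'
        · exact absurd (huniq x hx h' (h.trans hω.2.1)) h.ne
        · exact mul_nonneg_of_nonpos_of_nonpos (by linarith) (by linarith)) uP
    linarith [(le_div_iff₀ hpP).mpr hP]
end

section
/- Let H be a complex Hilbert space, A a bounded self-adjoint operator on H, and α ≤ β real numbers such that the open interval (α, β) contains no spectrum of A: there is no λ ∈ ℝ with α < λ < β and (λ : ℂ) ∈ spectrum ℂ A. Then for every x ∈ H, re⟪(A − α)x, (A − β)x⟫ ≥ 0. (Spectral-gap positivity inequality: the operator (A − α)(A − β) is nonnegative whenever the spectrum of A avoids the open interval (α, β); this is the key operator inequality underlying the Lehmann–Maehly–Goerisch/Zimmermann–Mertins eigenvalue bounds of the paper's Theorem 3.1.) -/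
open scoped InnerProductSpace

theorem IsSelfAdjoint.mul_sub_algebraMap_nonneg
    {H : Type*} [NormedAddCommGroup H] [InnerProductSpace ℂ H] [CompleteSpace H]
    {A : H →L[ℂ] H} (hA : IsSelfAdjoint A) {α β : ℝ}
    (hgap : ∀ t ∈ spectrum ℝ A, 0 ≤ (t - α) * (t - β)) :
    0 ≤ (A - algebraMap ℝ (H →L[ℂ] H) α) * (A - algebraMap ℝ (H →L[ℂ] H) β) := by
  have h : 0 ≤ cfc (fun t : ℝ => (t - α) * (t - β)) A := cfc_nonneg hgap
  rwa [cfc_mul (fun t : ℝ => t - α) (fun t : ℝ => t - β) A,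
    cfc_sub (fun t : ℝ => t) (fun _ => α) A, cfc_sub (fun t : ℝ => t) (fun _ => β) A,
    cfc_id' ℝ A, cfc_const α A, cfc_const β A] at h

theorem spectral_gap_positivity
    {H : Type*} [NormedAddCommGroup H] [InnerProductSpace ℂ H] [CompleteSpace H]
    (A : H →L[ℂ] H) (hA : IsSelfAdjoint A)
    (α β : ℝ) (hαβ : α ≤ β)
    (hgap : ¬ ∃ lam : ℝ, α < lam ∧ lam < β ∧ (lam : ℂ) ∈ spectrum ℂ A) :
    ∀ x : H, 0 ≤ (⟪(A - (α : ℂ) • 1) x, (A - (β : ℂ) • 1) x⟫_ℂ).re := by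
  intro x
  have hspec : ∀ t ∈ spectrum ℝ A, 0 ≤ (t - α) * (t - β) := by
    intro t ht
    have ht' : (t : ℂ) ∈ spectrum ℂ A := by
      simpa using spectrum.algebraMap_mem ℂ ht
    rcases le_or_gt t α with h | h
    · exact mul_nonneg_of_nonpos_of_nonpos (by linarith) (by linarith)
    · rcases lt_or_ge t β with h' | h'
      · exact absurd ⟨t, h, h', ht'⟩ hgap
      · exact mul_nonneg (by linarith) (by linarith)
  have hscalar (r : ℝ) : algebraMap ℝ (H →L[ℂ] H) r = (r : ℂ) • 1 := by
    rw [Algebra.algebraMap_eq_smul_one, Complex.coe_smul]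
  have hpos := hA.mul_sub_algebraMap_nonneg hspec
  have hadj : IsSelfAdjoint (A - (α : ℂ) • (1 : H →L[ℂ] H)) := by
    rw [← hscalar]
    exact hA.sub ((IsSelfAdjoint.all α).algebraMap _)
  rw [hscalar, hscalar, ContinuousLinearMap.nonneg_iff_isPositive] at hpos
  have hx := hpos.re_inner_nonneg_right x
  rw [← ContinuousLinearMap.adjoint_inner_right, hadj.adjoint_eq]
  exact hx
end

section
/- Let H be a complex Hilbert space, A a bounded self-adjoint operator on H, and λ < t real numbers such that: x ∈ H is a unit eigenvector with A x = λ • x, and A has no spectrum in the half-open interval (λ, t], i.e. there is no μ ∈ ℝ with λ < μ ≤ t and (μ : ℂ) ∈ spectrum ℂ A. Let (uₙ) be a sequence in H converging to x. Then there exists N such that for all n ≥ N: (A − t)uₙ ≠ 0, the Rayleigh quotient τₙ := re⟪(A − t)uₙ, uₙ⟫ / ‖(A − t)uₙ‖² is negative, and the number ρₙ := t + 1/τₙ satisfies ρₙ ≤ λ; moreover ρₙ → λ as n → ∞. (Combined abstract version of the paper's Theorems 3.1 and 3.2 for a single eigenvalue: the computed quantities ρₙ are guaranteed lower bounds for the eigenvalue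 λ adjacent to t from the left, and they converge to λ as the approximating vectors converge to the eigenvector; this is the property underpinning the certified enclosures of Procedure 4.1 and Lemma 4.2.) -/
open scoped InnerProductSpace

/-- A bounded self-adjoint operator without spectrum in `(a, b]` satisfies
`0 ≤ re ⟪(A - b) v, (A - a) v⟫` for every vector `v`. -/
theorem IsSelfAdjoint.re_inner_sub_smul_nonneg_of_gap
    {H : Type*} [NormedAddCommGroup H] [InnerProductSpace ℂ H] [CompleteSpace H]
    {A : H →L[ℂ] H} (hA : IsSelfAdjoint A) {a b : ℝ} (hab : a ≤ b)
    (hgap : ¬ ∃ μ : ℝ, a < μ ∧ μ ≤ b ∧ (μ : ℂ) ∈ spectrum ℂ A) (v : H) :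
    0 ≤ (⟪(A - (b : ℂ) • 1) v, (A - (a : ℂ) • 1) v⟫_ℂ).re := by
  have hsub : ∀ c : ℝ, cfc (fun s : ℝ => s - c) A = A - (c : ℂ) • 1 := by
    intro c
    rw [cfc_sub (fun s : ℝ => s) (fun _ => c) A, cfc_id' ℝ A, cfc_const c A,
      Algebra.algebraMap_eq_smul_one]
    rfl
  have hcfc : cfc (fun s : ℝ => (s - a) * (s - b)) A =
      (A - (a : ℂ) • 1) * (A - (b : ℂ) • 1) := by
    rw [cfc_mul (fun s : ℝ => s - a) (fun s : ℝ => s - b) A, hsub, hsub]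
  have hpos : 0 ≤ (A - (a : ℂ) • 1) * (A - (b : ℂ) • 1) := by
    rw [← hcfc]
    refine cfc_nonneg fun s hs => ?_
    have hs' : (s : ℂ) ∈ spectrum ℂ A := spectrum.algebraMap_mem ℂ hs
    rcases le_or_gt s a with h | h
    · exact mul_nonneg_of_nonpos_of_nonpos (by linarith) (by linarith)
    · have hbs : b < s := by
        by_contra! hsb
        exact hgap ⟨s, h, hsb, hs'⟩
      exact mul_nonneg (by linarith) (by linarith)
  have hadj : IsSelfAdjoint (A - (a : ℂ) • 1) := by
    rw [← hsub]
    exact cfc_predicate _ _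
  have h := ((ContinuousLinearMap.nonneg_iff_isPositive _).1 hpos).re_inner_nonneg_left v
  have hsymm := hadj.isSymmetric ((A - (b : ℂ) • 1) v) v
  exact h.trans_eq (congrArg Complex.re hsymm)

theorem certified_lower_bounds_converge_to_eigenvalue
    {H : Type*} [NormedAddCommGroup H] [InnerProductSpace ℂ H] [CompleteSpace H]
    (A : H →L[ℂ] H) (hA : IsSelfAdjoint A)
    (lam t : ℝ) (hlt : lam < t)
    (x : H) (hx : ‖x‖ = 1) (hev : A x = (lam : ℂ) • x)
    (hgap : ¬ ∃ μ : ℝ, lam < μ ∧ μ ≤ t ∧ (μ : ℂ) ∈ spectrum ℂ A)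
    (u : ℕ → H) (hu : Filter.Tendsto u Filter.atTop (nhds x)) :
    ∃ N : ℕ,
      (∀ n ≥ N,
        (A - (t : ℂ) • 1) (u n) ≠ 0 ∧
        (⟪(A - (t : ℂ) • 1) (u n), u n⟫_ℂ).re / ‖(A - (t : ℂ) • 1) (u n)‖ ^ 2 < 0 ∧
        t + 1 / ((⟪(A - (t : ℂ) • 1) (u n), u n⟫_ℂ).re / ‖(A - (t : ℂ) • 1) (u n)‖ ^ 2) ≤ lam) ∧
      Filter.Tendsto
        (fun n => t + 1 / ((⟪(A - (t : ℂ) • 1) (u n), u n⟫_ℂ).re / ‖(A - (t : ℂ) • 1) (u n)‖ ^ 2))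
        Filter.atTop (nhds lam) := by
  have hw : Filter.Tendsto (fun n => (A - (t : ℂ) • 1) (u n)) Filter.atTop
      (nhds (((lam - t : ℝ) : ℂ) • x)) := by
    have h := ((A - (t : ℂ) • 1).continuous.tendsto x).comp hu
    have hx' : (A - (t : ℂ) • 1) x = ((lam - t : ℝ) : ℂ) • x := by
      simp [hev, sub_smul]
    rwa [hx'] at h
  have hnorm : Filter.Tendsto (fun n => ‖(A - (t : ℂ) • 1) (u n)‖ ^ 2) Filter.atTop
      (nhds ((lam - t) ^ 2)) := by
    have h := hw.norm.pow 2
    rwa [norm_smul, hx, mul_one, Complex.norm_real, Real.norm_eq_abs, sq_abs] at h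
  have hre : Filter.Tendsto (fun n => (⟪(A - (t : ℂ) • 1) (u n), u n⟫_ℂ).re) Filter.atTop
      (nhds (lam - t)) := by
    have h := (Complex.continuous_re.tendsto _).comp (hw.inner hu)
    rwa [inner_smul_left, inner_self_eq_norm_sq_to_K, hx, Complex.conj_ofReal,
      RCLike.ofReal_one, one_pow, mul_one, Complex.ofReal_re] at h
  have hne : lam - t ≠ 0 := by linarith
  obtain ⟨N, hN⟩ := Filter.eventually_atTop.1
    (hre.eventually (gt_mem_nhds (by linarith : lam - t < 0)))
  refine ⟨N, fun n hn => ?_, ?_⟩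
  · have hr := hN n hn
    have hv := hA.re_inner_sub_smul_nonneg_of_gap hlt.le hgap (u n)
    have hw0 : (A - (t : ℂ) • 1) (u n) ≠ 0 := by
      intro h
      rw [h, inner_zero_left, Complex.zero_re] at hr
      exact hr.false
    have hshift : (A - (lam : ℂ) • 1) (u n) =
        (A - (t : ℂ) • 1) (u n) + ((t - lam : ℝ) : ℂ) • u n := by
      simp [sub_smul]
    rw [hshift, inner_add_right, inner_smul_right, inner_self_eq_norm_sq_to_K, Complex.add_re,
      Complex.re_ofReal_mul] at hv
    have hsq : (((‖(A - (t : ℂ) • 1) (u n)‖ : ℝ) : ℂ) ^ 2).re =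
        ‖(A - (t : ℂ) • 1) (u n)‖ ^ 2 := by
      rw [← Complex.ofReal_pow, Complex.ofReal_re]
    have hv' := hv.trans_eq (congrArg (· + _) hsq)
    refine ⟨hw0, div_neg_of_neg_of_pos hr (by positivity), ?_⟩
    rw [one_div_div]
    have := (div_le_iff_of_neg hr).2 (by linarith : (lam - t) * _ ≤ ‖(A - (t : ℂ) • 1) (u n)‖ ^ 2)
    linarith
  · have h := (hnorm.div hre hne).const_add t
    have hlim : t + (lam - t) ^ 2 / (lam - t) = lam := by
      field_simp
      ring
    rw [hlim] at h
    simpa only [one_div_div, Pi.div_apply] using h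
end
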